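/- Let γ ∈ (0,1), λ > 0, T ≥ 2, and let α_1, …, α_T ∈ L²(P) with ‖α_t‖_{L²(P)} ≤ R for all t. Set ρ_m = a(aR + Y) + 2Ra²/m and let P_T = ∑_{t=1}^{T−1} ‖α_{t+1} − α_t‖_{L²(P)} be the path length. Then γ ∑_{t=1}^{T−1} E[ F_t^γ(ŵ_{α_{t+1}}) − F_t^γ(ŵ_{α_t}) ] ≤ ( γ λ R + (γ/(1−γ)) ρ_m ) P_T. -/

import Mathlib

open MeasureTheory

/-- The discounted potential `F_t^γ(w) = γ^t (λ/2)‖w‖₂² + ∑_{s=1}^t γ^{t−s} ℓ_s(w)`,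
where `ℓ_s(w) = ½(⟨w, Φ_m(x_s)⟩ − y_s)²` over the random features
`Φ_m(x)(ω) = m^{-1/2}(φ(x;ω_1),…,φ(x;ω_m))`. -/
noncomputable def discountedPotential {Θ X : Type*} (φ : X → Θ → ℝ) (m : ℕ)
    (γ lam : ℝ) (xs : ℕ → X) (ys : ℕ → ℝ) (t : ℕ)
    (w : Fin m → ℝ) (ω : Fin m → Θ) : ℝ :=
  γ ^ t * (lam / 2) * ∑ i, (w i) ^ 2
    + ∑ s ∈ Finset.Icc 1 t,
        γ ^ (t - s) * ((∑ i, w i * (φ (xs s) (ω i) / Real.sqrt m)) - ys s) ^ 2 / 2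

/-- The Cauchy–Schwarz inequality for real functions in `L²(P)`. -/
lemma abs_integral_mul_le_eLpNorm_mul_eLpNorm {Θ : Type*} [MeasurableSpace Θ] {P : Measure Θ}
    {f g : Θ → ℝ} (hf : MemLp f 2 P) (hg : MemLp g 2 P) :
    |∫ θ, f θ * g θ ∂P| ≤ (eLpNorm f 2 P).toReal * (eLpNorm g 2 P).toReal := by
  have h := abs_real_inner_le_norm (hf.toLp f) (hg.toLp g)
  rw [L2.inner_def, Lp.norm_toLp, Lp.norm_toLp] at h
  convert h using 2
  apply integral_congr_ae
  filter_upwards [hf.coeFn_toLp, hg.coeFn_toLp] with θ h₁ h₂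
  simp [h₁, h₂, mul_comm]

/-- On a probability space the `L¹`-mean is controlled by the `L²`-norm. -/
lemma abs_integral_le_eLpNorm_two {Θ : Type*} [MeasurableSpace Θ] {P : Measure Θ}
    [IsProbabilityMeasure P] {f : Θ → ℝ} (hf : MemLp f 2 P) :
    |∫ θ, f θ ∂P| ≤ (eLpNorm f 2 P).toReal := by
  simpa [eLpNorm_const (1 : ℝ) two_ne_zero (IsProbabilityMeasure.ne_zero P)] using
    abs_integral_mul_le_eLpNorm_mul_eLpNorm hf (memLp_const (μ := P) (p := 2) (1 : ℝ))

lemma memLp_mul_of_abs_le {Θ : Type*} [MeasurableSpace Θ] {P : Measure Θ} {a : ℝ}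
    {f ψ : Θ → ℝ} (hf : MemLp f 2 P) (hψ : Measurable ψ) (hb : ∀ θ, |ψ θ| ≤ a) :
    MemLp (fun θ => f θ * ψ θ) 2 P := by
  refine hf.of_le_mul (c := a) (hf.1.mul hψ.aestronglyMeasurable) (ae_of_all _ fun θ => ?_)
  rw [norm_mul, mul_comm]
  exact mul_le_mul_of_nonneg_right (hb θ) (norm_nonneg _)

lemma eLpNorm_mul_toReal_le_of_abs_le {Θ : Type*} [MeasurableSpace Θ] {P : Measure Θ} {a : ℝ}
    (ha : 0 ≤ a) {f ψ : Θ → ℝ} (hf : MemLp f 2 P) (hb : ∀ θ, |ψ θ| ≤ a) :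
    (eLpNorm (fun θ => f θ * ψ θ) 2 P).toReal ≤ a * (eLpNorm f 2 P).toReal := by
  have h : eLpNorm (fun θ => f θ * ψ θ) 2 P ≤ ENNReal.ofReal a * eLpNorm f 2 P := by
    refine eLpNorm_le_mul_eLpNorm_of_ae_le_mul (ae_of_all _ fun θ => ?_) 2
    rw [norm_mul, mul_comm]
    exact mul_le_mul_of_nonneg_right (hb θ) (norm_nonneg _)
  have h' := ENNReal.toReal_mono (ENNReal.mul_ne_top ENNReal.ofReal_ne_top hf.2.ne) h
  rwa [ENNReal.toReal_mul, ENNReal.toReal_ofReal ha] at h'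

section IIDSample

variable {Θ : Type*} [MeasurableSpace Θ] {P : Measure Θ} [IsProbabilityMeasure P] {m : ℕ}

lemma memLp_comp_eval {f : Θ → ℝ} (hf : MemLp f 2 P) (i : Fin m) :
    MemLp (fun ω : Fin m → Θ => f (ω i)) 2 (Measure.pi fun _ => P) :=
  hf.comp_measurePreserving (measurePreserving_eval (fun _ : Fin m => P) i)

lemma integral_comp_eval_of_aestronglyMeasurable {f : Θ → ℝ} (hf : AEStronglyMeasurable f P)
    (i : Fin m) :
    ∫ ω : Fin m → Θ, f (ω i) ∂(Measure.pi fun _ => P) = ∫ θ, f θ ∂P := by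
  have h := measurePreserving_eval (fun _ : Fin m => P) i
  have hf' : AEStronglyMeasurable f (Measure.map (Function.eval i) (Measure.pi fun _ => P)) := by
    rwa [h.map_eq]
  have := integral_map h.measurable.aemeasurable hf'
  rw [h.map_eq] at this
  exact this.symm

lemma integrable_comp_eval_of_integrable {f : Θ → ℝ} (hf : Integrable f P) (i : Fin m) :
    Integrable (fun ω : Fin m → Θ => f (ω i)) (Measure.pi fun _ => P) :=
  (measurePreserving_eval (fun _ : Fin m => P) i).integrable_comp_of_integrable hf

lemma integrable_sum_comp_eval {f : Θ → ℝ} (hf : Integrable f P) :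
    Integrable (fun ω : Fin m → Θ => ∑ i, f (ω i)) (Measure.pi fun _ => P) :=
  integrable_finsetSum _ fun i _ => integrable_comp_eval_of_integrable hf i

lemma integral_sum_comp_eval {f : Θ → ℝ} (hf : Integrable f P) :
    ∫ ω : Fin m → Θ, ∑ i, f (ω i) ∂(Measure.pi fun _ => P) = m * ∫ θ, f θ ∂P := by
  rw [integral_finsetSum _ fun i _ => integrable_comp_eval_of_integrable hf i]
  simp [integral_comp_eval_of_aestronglyMeasurable hf.1]

lemma integrable_sum_mul_sum_comp_eval {f g : Θ → ℝ} (hf : MemLp f 2 P) (hg : MemLp g 2 P) :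
    Integrable (fun ω : Fin m → Θ => (∑ i, f (ω i)) * ∑ i, g (ω i))
      (Measure.pi fun _ => P) :=
  (memLp_finsetSum _ fun i _ => memLp_comp_eval hf i).integrable_mul
    (memLp_finsetSum _ fun i _ => memLp_comp_eval hg i)

/-- The mixed second moment of two sums over the same i.i.d. sample. -/
lemma integral_sum_mul_sum_comp_eval {f g : Θ → ℝ} (hf : MemLp f 2 P) (hg : MemLp g 2 P) :
    ∫ ω : Fin m → Θ, (∑ i, f (ω i)) * ∑ i, g (ω i) ∂(Measure.pi fun _ => P)
      = m * ∫ θ, f θ * g θ ∂P + m * (m - 1) * ((∫ θ, f θ ∂P) * ∫ θ, g θ ∂P) := by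
  have hterm : ∀ i j : Fin m,
      ∫ ω : Fin m → Θ, f (ω i) * g (ω j) ∂(Measure.pi fun _ => P)
        = (∫ θ, f θ ∂P) * (∫ θ, g θ ∂P)
          + if i = j then (∫ θ, f θ * g θ ∂P) - (∫ θ, f θ ∂P) * (∫ θ, g θ ∂P) else 0 := by
    intro i j
    split_ifs with hij
    · subst hij
      rw [integral_comp_eval_of_aestronglyMeasurable (f := fun θ => f θ * g θ)
        (hf.1.mul hg.1) i]
      ring
    · have hind := (ProbabilityTheory.iIndepFun_pi (μ := fun _ : Fin m => P)
        (X := fun _ θ => θ) fun _ => aemeasurable_id).indepFun hij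
      have hmap : ∀ k : Fin m,
          Measure.map (fun ω : Fin m → Θ => ω k) (Measure.pi fun _ => P) = P :=
        fun k => (measurePreserving_eval (fun _ : Fin m => P) k).map_eq
      have hind' : ProbabilityTheory.IndepFun (fun ω : Fin m → Θ => f (ω i))
          (fun ω => g (ω j)) (Measure.pi fun _ => P) := by
        refine hind.comp₀ (φ := f) (ψ := g) (measurable_pi_apply i).aemeasurable
          (measurable_pi_apply j).aemeasurable ?_ ?_
        · rw [hmap]; exact hf.1.aemeasurable
        · rw [hmap]; exact hg.1.aemeasurable
      have h := hind'.integral_fun_mul_eq_mul_integral (memLp_comp_eval hf i).1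
        (memLp_comp_eval hg j).1
      rw [h, integral_comp_eval_of_aestronglyMeasurable hf.1,
        integral_comp_eval_of_aestronglyMeasurable hg.1, add_zero]
  have hint : ∀ i j : Fin m, Integrable (fun ω : Fin m → Θ => f (ω i) * g (ω j))
      (Measure.pi fun _ => P) :=
    fun i j => (memLp_comp_eval hf i).integrable_mul (memLp_comp_eval hg j)
  simp_rw [Finset.sum_mul_sum]
  rw [integral_finsetSum _ fun i _ => integrable_finsetSum _ fun j _ => hint i j]
  simp_rw [integral_finsetSum _ fun j _ => hint _ j, hterm, Finset.sum_add_distrib]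
  simp
  ring

end IIDSample

lemma sum_Icc_pow_sub_le {γ : ℝ} (h0 : 0 ≤ γ) (h1 : γ < 1) (t : ℕ) :
    ∑ s ∈ Finset.Icc 1 t, γ ^ (t - s) ≤ 1 / (1 - γ) := by
  have h : ∑ s ∈ Finset.Icc 1 t, γ ^ (t - s) = ∑ k ∈ Finset.range t, γ ^ k := by
    refine Finset.sum_nbij' (fun s => t - s) (fun k => t - k) ?_ ?_ ?_ ?_ ?_ <;>
      simp only [Finset.mem_Icc, Finset.mem_range, implies_true] <;> intros <;> omega
  rw [h, one_div, ← tsum_geometric_of_lt_one h0 h1]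
  exact (summable_geometric_of_lt_one h0 h1).sum_le_tsum _ fun _ _ => pow_nonneg h0 _

/-- The increment of the discounted potential, written with sums over the sample of
`g - f` and `g + f`. -/
lemma discountedPotential_sub {Θ X : Type*} (φ : X → Θ → ℝ) (m : ℕ) (γ lam : ℝ)
    (xs : ℕ → X) (ys : ℕ → ℝ) (t : ℕ) (f g : Θ → ℝ) (ω : Fin m → Θ) :
    discountedPotential φ m γ lam xs ys t (fun i => g (ω i) / Real.sqrt m) ω
        - discountedPotential φ m γ lam xs ys t (fun i => f (ω i) / Real.sqrt m) ω
      = γ ^ t * (lam / 2) * ((∑ i, (g (ω i) - f (ω i)) * (g (ω i) + f (ω i))) / m)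
        + ∑ s ∈ Finset.Icc 1 t, γ ^ (t - s) *
          (((∑ i, (g (ω i) - f (ω i)) * φ (xs s) (ω i))
              * ∑ i, (g (ω i) + f (ω i)) * φ (xs s) (ω i)) / (2 * m ^ 2)
            - ys s / m * ∑ i, (g (ω i) - f (ω i)) * φ (xs s) (ω i)) := by
  have hsq : ∀ h : Θ → ℝ, ∑ i, (h (ω i) / Real.sqrt m) ^ 2 = (∑ i, h (ω i) ^ 2) / m := by
    intro h
    simp_rw [div_pow, Real.sq_sqrt (Nat.cast_nonneg m), Finset.sum_div]
  have hpr : ∀ (h : Θ → ℝ) (s : ℕ),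
      ∑ i, h (ω i) / Real.sqrt m * (φ (xs s) (ω i) / Real.sqrt m)
        = (∑ i, h (ω i) * φ (xs s) (ω i)) / m := by
    intro h s
    simp_rw [div_mul_div_comm, Real.mul_self_sqrt (Nat.cast_nonneg m), Finset.sum_div]
  unfold discountedPotential
  simp_rw [hsq, hpr]
  rw [add_sub_add_comm, ← Finset.sum_sub_distrib]
  congr 1
  · rw [← mul_sub, ← sub_div, ← Finset.sum_sub_distrib]
    simp_rw [sq_sub_sq, mul_comm]
  · refine Finset.sum_congr rfl fun s _ => ?_
    simp_rw [sub_mul, add_mul, Finset.sum_sub_distrib, Finset.sum_add_distrib]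
    ring

/-- The expected change of a squared loss under a change of the comparator. -/
lemma loss_increment_le {m : ℕ} (hm : 1 ≤ m) {a R Y d U V W y : ℝ} (ha : 0 ≤ a) (hR : 0 ≤ R)
    (hd : 0 ≤ d) (hy : |y| ≤ Y) (hU : |U| ≤ a * d) (hV : |V| ≤ a * (2 * R))
    (hW : |W| ≤ a * d * (a * (2 * R))) :
    (m * W + m * (m - 1) * (U * V)) / (2 * m ^ 2) - y / m * (m * U)
      ≤ (a * (a * R + Y) + 2 * R * a ^ 2 / m) * d := by
  have hm1 : (1 : ℝ) ≤ m := by exact_mod_cast hm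
  have hm0 : (0 : ℝ) < m := by linarith
  have hUV : U * V ≤ a * d * (a * (2 * R)) :=
    (le_abs_self _).trans (by rw [abs_mul]; gcongr)
  have hyU : -(y * U) ≤ Y * (a * d) :=
    (neg_le_abs _).trans (by
      rw [abs_mul]
      exact mul_le_mul hy hU (abs_nonneg _) ((abs_nonneg _).trans hy))
  have hW' := (le_abs_self W).trans hW
  have hmm : 0 ≤ 1 - 1 / (m : ℝ) := by
    rw [sub_nonneg, div_le_one hm0]; exact hm1
  have hK : 0 ≤ a * d * (a * (2 * R)) := by positivity
  have heq : (m * W + m * (m - 1) * (U * V)) / (2 * (m : ℝ) ^ 2) - y / m * (m * U)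
      = (1 / m) * W / 2 + (1 - 1 / m) * (U * V) / 2 + -(y * U) := by
    field_simp
    ring
  have h1 : (1 / (m : ℝ)) * W ≤ (1 / m) * (a * d * (a * (2 * R))) := by gcongr
  have h2 : (1 - 1 / (m : ℝ)) * (U * V) ≤ 1 * (a * d * (a * (2 * R))) :=
    (mul_le_mul_of_nonneg_left hUV hmm).trans (by
      gcongr
      linarith [one_div_pos.mpr hm0])
  have h3 : (a * (a * R + Y) + 2 * R * a ^ 2 / m) * d
      = a * d * (a * (2 * R)) / 2 + Y * (a * d) + (1 / m) * (a * d * (a * (2 * R))) := by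
    field_simp
  have h4 : 0 ≤ (1 / (m : ℝ)) * (a * d * (a * (2 * R))) := by positivity
  rw [heq, h3]
  linarith

/-- The expected one-step change of the discounted potential. -/
lemma integral_discountedPotential_sub_le
    {Θ : Type*} [MeasurableSpace Θ] {P : Measure Θ} [IsProbabilityMeasure P]
    {X : Type*} {a R Y : ℝ} (ha : 0 ≤ a) (hR : 0 ≤ R) (hY : 0 ≤ Y) {φ : X → Θ → ℝ}
    (hmeas : ∀ x, Measurable (φ x)) (hbound : ∀ x θ, |φ x θ| ≤ a) {m : ℕ} (hm : 1 ≤ m)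
    {γ lam : ℝ} (hγ0 : 0 ≤ γ) (hγ1 : γ < 1) (hlam : 0 ≤ lam)
    (xs : ℕ → X) {ys : ℕ → ℝ} {t : ℕ} (hy : ∀ s ∈ Finset.Icc 1 t, |ys s| ≤ Y)
    {f g : Lp ℝ 2 P} (hf : ‖f‖ ≤ R) (hg : ‖g‖ ≤ R) :
    (∫ ω : Fin m → Θ,
        (discountedPotential φ m γ lam xs ys t (fun i => g (ω i) / Real.sqrt m) ω
          - discountedPotential φ m γ lam xs ys t (fun i => f (ω i) / Real.sqrt m) ω)
        ∂(Measure.pi fun _ => P))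
      ≤ (lam * R + 1 / (1 - γ) * (a * (a * R + Y) + 2 * R * a ^ 2 / m)) * ‖g - f‖ := by
  have hm0 : (0 : ℝ) < m := by exact_mod_cast hm
  have hD : MemLp (fun θ => g θ - f θ) 2 P := (Lp.memLp g).sub (Lp.memLp f)
  have hS : MemLp (fun θ => g θ + f θ) 2 P := (Lp.memLp g).add (Lp.memLp f)
  have hDn : (eLpNorm (fun θ => g θ - f θ) 2 P).toReal = ‖g - f‖ := by
    rw [Lp.norm_def]
    exact congrArg _ (eLpNorm_congr_ae (Lp.coeFn_sub g f).symm)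
  have hSn : (eLpNorm (fun θ => g θ + f θ) 2 P).toReal ≤ 2 * R := by
    have h : (eLpNorm (fun θ => g θ + f θ) 2 P).toReal = ‖g + f‖ := by
      rw [Lp.norm_def]
      exact congrArg _ (eLpNorm_congr_ae (Lp.coeFn_add g f).symm)
    linarith [norm_add_le g f]
  have hu := fun s => memLp_mul_of_abs_le hD (hmeas (xs s)) (hbound (xs s))
  have hv := fun s => memLp_mul_of_abs_le hS (hmeas (xs s)) (hbound (xs s))
  have hun := fun s => eLpNorm_mul_toReal_le_of_abs_le ha hD (hbound (xs s))
  have hvn := fun s => (eLpNorm_mul_toReal_le_of_abs_le ha hS (hbound (xs s))).trans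
    (mul_le_mul_of_nonneg_left hSn ha)
  simp_rw [hDn] at hun
  have hDS : Integrable (fun θ => (g θ - f θ) * (g θ + f θ)) P := hD.integrable_mul hS
  have hui := fun s => (hu s).integrable one_le_two
  have hloss : ∀ s, Integrable (fun ω : Fin m → Θ =>
      ((∑ i, (g (ω i) - f (ω i)) * φ (xs s) (ω i))
          * ∑ i, (g (ω i) + f (ω i)) * φ (xs s) (ω i)) / (2 * m ^ 2)
        - ys s / m * ∑ i, (g (ω i) - f (ω i)) * φ (xs s) (ω i)) (Measure.pi fun _ => P) := fun s =>
    ((integrable_sum_mul_sum_comp_eval (m := m) (hu s) (hv s)).div_const (2 * (m : ℝ) ^ 2)).sub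
      ((integrable_sum_comp_eval (m := m) (hui s)).const_mul (ys s / m))
  simp_rw [discountedPotential_sub]
  rw [integral_add (((integrable_sum_comp_eval hDS).div_const _).const_mul _)
      (integrable_finsetSum _ fun s _ => (hloss s).const_mul _),
    integral_finsetSum _ fun s _ => (hloss s).const_mul _, integral_const_mul, integral_div,
    integral_sum_comp_eval hDS, add_mul]
  refine add_le_add ?_ ?_
  · have h := (le_abs_self _).trans (abs_integral_mul_le_eLpNorm_mul_eLpNorm hD hS)
    rw [hDn] at h
    have h' : ∫ θ, (g θ - f θ) * (g θ + f θ) ∂P ≤ ‖g - f‖ * (2 * R) :=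
      h.trans (mul_le_mul_of_nonneg_left hSn (norm_nonneg _))
    rw [mul_div_cancel_left₀ _ hm0.ne']
    calc γ ^ t * (lam / 2) * ∫ θ, (g θ - f θ) * (g θ + f θ) ∂P
        ≤ γ ^ t * (lam / 2) * (‖g - f‖ * (2 * R)) := by gcongr
      _ ≤ 1 * (lam / 2) * (‖g - f‖ * (2 * R)) := by
          gcongr
          exact pow_le_one₀ hγ0 hγ1.le
      _ = lam * R * ‖g - f‖ := by ring
  · refine (Finset.sum_le_sum (g := fun s => γ ^ (t - s) *
      ((a * (a * R + Y) + 2 * R * a ^ 2 / m) * ‖g - f‖)) fun s hs => ?_).trans ?_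
    · rw [integral_const_mul, integral_sub
        ((integrable_sum_mul_sum_comp_eval (hu s) (hv s)).div_const _)
        ((integrable_sum_comp_eval (hui s)).const_mul _), integral_div, integral_const_mul,
        integral_sum_mul_sum_comp_eval (hu s) (hv s), integral_sum_comp_eval (hui s)]
      refine mul_le_mul_of_nonneg_left (loss_increment_le hm ha hR (norm_nonneg _) (hy s hs)
        ((abs_integral_le_eLpNorm_two (hu s)).trans (hun s))
        ((abs_integral_le_eLpNorm_two (hv s)).trans (hvn s))
        ((abs_integral_mul_le_eLpNorm_mul_eLpNorm (hu s) (hv s)).trans ?_)) (pow_nonneg hγ0 _)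
      exact mul_le_mul (hun s) (hvn s) ENNReal.toReal_nonneg (by positivity)
    rw [← Finset.sum_mul, mul_assoc (1 / (1 - γ))]
    exact mul_le_mul_of_nonneg_right (sum_Icc_pow_sub_le hγ0 hγ1 t) (by positivity)

/-- For `γ ∈ (0,1)`, `λ > 0`, `T ≥ 2` and comparators `α_1,…,α_T` with `L²(P)`-norms
bounded by `R`:
`γ ∑_{t=1}^{T−1} E[F_t^γ(ŵ_{α_{t+1}}) − F_t^γ(ŵ_{α_t})] ≤ (γλR + (γ/(1−γ)) ρ_m) P_T`,
where `ρ_m = a(aR + Y) + 2Ra²/m` and `P_T = ∑_{t=1}^{T−1} ‖α_{t+1} − α_t‖_{L²(P)}`. -/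
theorem summed_potential_variation_bound
    {Θ : Type*} [MeasurableSpace Θ] (P : Measure Θ) [IsProbabilityMeasure P]
    {X : Type*} (a : ℝ) (ha : 0 < a) (R : ℝ) (hR : 0 < R) (Y : ℝ) (hY : 0 < Y)
    (φ : X → Θ → ℝ)
    (hmeas : ∀ x, Measurable (φ x)) (hbound : ∀ x θ, |φ x θ| ≤ a)
    (m : ℕ) (hm : 1 ≤ m)
    (γ : ℝ) (hγ : γ ∈ Set.Ioo (0 : ℝ) 1) (lam : ℝ) (hlam : 0 < lam)
    (T : ℕ) (hT : 2 ≤ T)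
    (xs : ℕ → X) (ys : ℕ → ℝ) (hy : ∀ s ∈ Finset.Icc 1 T, |ys s| ≤ Y)
    (αs : ℕ → Lp ℝ 2 P) (hα : ∀ t ∈ Finset.Icc 1 T, ‖αs t‖ ≤ R) :
    γ * ∑ t ∈ Finset.Icc 1 (T - 1),
        (∫ ω : Fin m → Θ,
          (discountedPotential φ m γ lam xs ys t (fun i => αs (t + 1) (ω i) / Real.sqrt m) ω
            - discountedPotential φ m γ lam xs ys t (fun i => αs t (ω i) / Real.sqrt m) ω)
          ∂(Measure.pi fun _ => P)) ≤
      (γ * lam * R + γ / (1 - γ) * (a * (a * R + Y) + 2 * R * a ^ 2 / m)) *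
        ∑ t ∈ Finset.Icc 1 (T - 1), ‖αs (t + 1) - αs t‖ := by
  obtain ⟨hγ0, hγ1⟩ := hγ
  rw [Finset.mul_sum, Finset.mul_sum]
  refine Finset.sum_le_sum fun t ht => ?_
  rw [Finset.mem_Icc] at ht
  have h := integral_discountedPotential_sub_le ha.le hR.le hY.le hmeas hbound hm hγ0.le hγ1
    hlam.le xs (t := t)
    (fun s hs => hy s (Finset.mem_Icc.mpr (by rw [Finset.mem_Icc] at hs; omega)))
    (hα t (Finset.mem_Icc.mpr (by omega))) (hα (t + 1) (Finset.mem_Icc.mpr (by omega)))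
  refine (mul_le_mul_of_nonneg_left h hγ0.le).trans_eq ?_
  ring
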